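/- Let P be an odd prime, n ≥ 4 a natural number, and Δ, Γ ∈ ℤ_P. Let v' ∈ (ℤ_P)^n be any vector with v'₁ = −Γ, v'₂ = −1, v'₃ = 1, v'₄ = Δ·2^{−1} (the remaining coordinates arbitrary). Define s₀, s₁, s₂ ∈ (ℤ_P)^n by: s₀ has third coordinate Δ and fourth coordinate −2 with all other coordinates 0; s₁ has second and third coordinates 1 with all other coordinates 0; s₂ has first coordinate −2 and second coordinate 2Γ with all other coordinates 0. Then v'·s₀ = v'·s₁ = v'·s₂ = 0; moreover, if Δ ≠ 0 then s₀, s₁, s₂ are linearly independent over ℤ_P. -/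

import Mathlib

/-- A dot product with a vector supported on the first `m` coordinates. -/
theorem sum_mul_eq_sum_castLE {R : Type*} [NonUnitalNonAssocSemiring R] {m n : ℕ}
    (hn : m ≤ n) (v s : Fin n → R) (hs : ∀ i : Fin n, m ≤ (i : ℕ) → s i = 0) :
    ∑ i, v i * s i = ∑ j : Fin m, v (Fin.castLE hn j) * s (Fin.castLE hn j) := by
  obtain ⟨k, rfl⟩ := Nat.exists_eq_add_of_le hn
  rw [Fin.sum_univ_add,
    Finset.sum_eq_zero (s := (Finset.univ : Finset (Fin k))), add_zero]
  · rfl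
  · intro i _
    rw [hs _ (by simp), mul_zero]

/-- The flaw analysis of the Khesin–Lu–Shor scheme: the public vector `v'` (first four
coordinates `-Γ, -1, 1, Δ/2`, remaining arbitrary) is orthogonal to the three short vectors
`s₀, s₁, s₂`, and if `Δ ≠ 0` these three vectors are linearly independent over `ℤ_P`. -/
theorem kls_orthogonal_short_vectors
    (P : ℕ) [Fact P.Prime] (hodd : P ≠ 2) (n : ℕ) (hn : 4 ≤ n)
    (Δ Γ : ZMod P) (v' : Fin n → ZMod P)
    (hv1 : v' ⟨0, by omega⟩ = -Γ)
    (hv2 : v' ⟨1, by omega⟩ = -1)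
    (hv3 : v' ⟨2, by omega⟩ = 1)
    (hv4 : v' ⟨3, by omega⟩ = Δ * (2 : ZMod P)⁻¹)
    (s₀ s₁ s₂ : Fin n → ZMod P)
    (hs₀ : ∀ i : Fin n, s₀ i =
      if (i : ℕ) = 2 then Δ else if (i : ℕ) = 3 then -2 else 0)
    (hs₁ : ∀ i : Fin n, s₁ i =
      if (i : ℕ) = 1 ∨ (i : ℕ) = 2 then 1 else 0)
    (hs₂ : ∀ i : Fin n, s₂ i =
      if (i : ℕ) = 0 then -2 else if (i : ℕ) = 1 then 2 * Γ else 0) :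
    (∑ i, v' i * s₀ i = 0) ∧ (∑ i, v' i * s₁ i = 0) ∧ (∑ i, v' i * s₂ i = 0) ∧
    (Δ ≠ 0 → LinearIndependent (ZMod P) ![s₀, s₁, s₂]) := by
  have h2 : (2 : ZMod P) ≠ 0 := Ring.two_ne_zero (by rwa [ZMod.ringChar_zmod_n])
  replace hv1 : v' (Fin.castLE hn 0) = -Γ := hv1
  replace hv2 : v' (Fin.castLE hn 1) = -1 := hv2
  replace hv3 : v' (Fin.castLE hn 2) = 1 := hv3
  replace hv4 : v' (Fin.castLE hn 3) = Δ * (2 : ZMod P)⁻¹ := hv4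
  refine ⟨?_, ?_, ?_, fun _ => ?_⟩
  · rw [sum_mul_eq_sum_castLE hn v' s₀ fun i hi => by
      rw [hs₀, if_neg (by omega), if_neg (by omega)], Fin.sum_univ_four]
    simp [hs₀, hv3, hv4, h2]
  · rw [sum_mul_eq_sum_castLE hn v' s₁ fun i hi => by
      rw [hs₁, if_neg (by omega)], Fin.sum_univ_four]
    simp [hs₁, hv2, hv3]
  · rw [sum_mul_eq_sum_castLE hn v' s₂ fun i hi => by
      rw [hs₂, if_neg (by omega), if_neg (by omega)], Fin.sum_univ_four]
    simp only [hs₂, hv1, hv2]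
    norm_num
    ring
  · rw [Fintype.linearIndependent_iff]
    intro g hg
    have coord (k : Fin n) : g 0 * s₀ k + g 1 * s₁ k + g 2 * s₂ k = 0 := by
      simpa [Fin.sum_univ_three] using congrFun hg k
    have h_zero : g 0 = 0 := by simpa [hs₀, hs₁, hs₂, h2] using coord ⟨3, by omega⟩
    have h_one : g 1 = 0 := by simpa [hs₀, hs₁, hs₂, h_zero] using coord ⟨2, by omega⟩
    have h_two : g 2 = 0 := by simpa [hs₀, hs₁, hs₂, h2] using coord ⟨0, by omega⟩
    intro i
    fin_cases i
    exacts [h_zero, h_one, h_two]
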